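/- arXiv:2211.13441 — 9 statements merged into one kernel-verified Lean document; each statement's English description precedes it below -/
import Mathlib

section
/- Let X be a non-negative random variable with finite negative cumulative extropy η̄J(X) and finite weighted negative cumulative extropy η̄¹J(X), and let a > 0 and b ≥ 0. Then for Y = aX + b, η̄¹J(Y) = a² η̄¹J(X) + ab η̄J(X) + b²/4. -/
open MeasureTheory Real

theorem image_affine_Ioi_zero {a : ℝ} (ha : 0 < a) (b : ℝ) :
    (fun x => a * x + b) '' Set.Ioi 0 = Set.Ioi b := by
  ext y
  simp only [Set.mem_image, Set.mem_Ioi]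
  constructor
  · rintro ⟨x, hx, rfl⟩
    have := mul_pos ha hx
    linarith
  · intro hy
    exact ⟨(y - b) / a, div_pos (sub_pos.2 hy) ha, by field_simp; ring⟩

theorem hasDerivWithinAt_affine (a b x : ℝ) (s : Set ℝ) :
    HasDerivWithinAt (fun x => a * x + b) a s x := by
  simpa using (((hasDerivAt_id x).const_mul a).add_const b).hasDerivWithinAt

theorem injective_affine {a : ℝ} (ha : 0 < a) (b : ℝ) :
    Function.Injective fun x => a * x + b := by
  intro x y h
  exact mul_left_cancel₀ ha.ne' (add_right_cancel h)

theorem integral_Ioi_affine {a : ℝ} (ha : 0 < a) (b : ℝ) (g : ℝ → ℝ) :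
    ∫ y in Set.Ioi b, g y = a * ∫ x in Set.Ioi 0, g (a * x + b) := by
  rw [← image_affine_Ioi_zero ha b, integral_image_eq_integral_abs_deriv_smul measurableSet_Ioi
    (fun x _ => hasDerivWithinAt_affine a b x _) (injective_affine ha b).injOn]
  simp only [abs_of_pos ha, smul_eq_mul, integral_const_mul]

theorem integrableOn_Ioi_affine {a : ℝ} (ha : 0 < a) (b : ℝ) {g : ℝ → ℝ}
    (hg : IntegrableOn (fun x => g (a * x + b)) (Set.Ioi 0)) : IntegrableOn g (Set.Ioi b) := by
  rw [← image_affine_Ioi_zero ha b, integrableOn_image_iff_integrableOn_abs_deriv_smul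
    measurableSet_Ioi (fun x _ => hasDerivWithinAt_affine a b x _) (injective_affine ha b).injOn]
  exact hg.smul |a|

/-- For a non-negative random variable `X` with finite negative cumulative
extropy and finite weighted negative cumulative extropy, and `Y = aX + b` with `a > 0`,
`b ≥ 0`, one has `η̄¹J(Y) = a² η̄¹J(X) + a b η̄J(X) + b²/4`. -/
theorem wncj_linear_transform
    {Ω : Type*} [MeasurableSpace Ω] (μ : Measure Ω) [IsProbabilityMeasure μ]
    (X : Ω → ℝ) (hX : Measurable X) (h0 : ∀ ω, 0 ≤ X ω)
    (a b : ℝ) (ha : 0 < a) (hb : 0 ≤ b)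
    (F G : ℝ → ℝ)
    (hF : ∀ x, F x = (μ {ω | X ω ≤ x}).toReal)
    (hG : ∀ y, G y = (μ {ω | a * X ω + b ≤ y}).toReal)
    (hint1 : IntegrableOn (fun x => x * (1 - F x ^ 2)) (Set.Ioi 0))
    (hint2 : IntegrableOn (fun x => 1 - F x ^ 2) (Set.Ioi 0)) :
    (1 / 2) * ∫ y in Set.Ioi (0 : ℝ), y * (1 - G y ^ 2)
      = a ^ 2 * ((1 / 2) * ∫ x in Set.Ioi (0 : ℝ), x * (1 - F x ^ 2))
        + a * b * ((1 / 2) * ∫ x in Set.Ioi (0 : ℝ), (1 - F x ^ 2))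
        + b ^ 2 / 4 := by
  have hGF (x : ℝ) : G (a * x + b) = F x := by
    simp only [hG, hF, add_le_add_iff_right, mul_le_mul_iff_right₀ ha]
  have hG0 {y : ℝ} (hy : y < b) : G y = 0 := by
    have : {ω | a * X ω + b ≤ y} = ∅ := by
      ext ω
      have := mul_nonneg ha.le (h0 ω)
      simp only [Set.mem_ofPred_eq, Set.mem_empty_iff_false, iff_false]
      linarith
    rw [hG, this, measure_empty, ENNReal.toReal_zero]
  have hcomp : (fun x => (a * x + b) * (1 - G (a * x + b) ^ 2))
      = fun x => a * (x * (1 - F x ^ 2)) + b * (1 - F x ^ 2) := by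
    funext x
    rw [hGF]
    ring
  have hupper_int : IntegrableOn (fun y => y * (1 - G y ^ 2)) (Set.Ioi b) := by
    apply integrableOn_Ioi_affine ha b
    rw [hcomp]
    exact (hint1.const_mul a).add (hint2.const_mul b)
  have hupper : ∫ y in Set.Ioi b, y * (1 - G y ^ 2)
      = a * (a * (∫ x in Set.Ioi 0, x * (1 - F x ^ 2))
        + b * ∫ x in Set.Ioi 0, (1 - F x ^ 2)) := by
    rw [integral_Ioi_affine ha b, hcomp,
      integral_add (hint1.const_mul a) (hint2.const_mul b), integral_const_mul,
      integral_const_mul]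
  have heq : Set.EqOn (fun y => y * (1 - G y ^ 2)) (fun y => y) (Set.Ioo 0 b) := by
    intro y hy
    simp [hG0 hy.2]
  have hlower_int : IntegrableOn (fun y => y * (1 - G y ^ 2)) (Set.Ioc 0 b) := by
    rw [integrableOn_Ioc_iff_integrableOn_Ioo, integrableOn_congr_fun heq measurableSet_Ioo]
    exact continuous_id.integrableOn_Icc.mono_set Set.Ioo_subset_Icc_self
  have hlower : ∫ y in Set.Ioc 0 b, y * (1 - G y ^ 2) = b ^ 2 / 2 := by
    rw [integral_Ioc_eq_integral_Ioo, setIntegral_congr_fun measurableSet_Ioo heq,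
      ← integral_Ioc_eq_integral_Ioo, ← intervalIntegral.integral_of_le hb, integral_id]
    ring
  rw [← Set.Ioc_union_Ioi_eq_Ioi hb, setIntegral_union (Set.Ioc_disjoint_Ioi le_rfl)
    measurableSet_Ioi hlower_int hupper_int, hlower, hupper, Set.Ioc_union_Ioi_eq_Ioi hb]
  ring
end

section
/- Let X be a non-negative random variable with cumulative distribution function F. Then the weighted negative cumulative extropy satisfies η̄¹J(X) = 0 if and only if X is degenerate at 0, i.e., P(X = 0) = 1. -/
open MeasureTheory Real

/-- For a non-negative random variable `X` with cdf `F`, the weighted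
negative cumulative extropy `η̄¹J(X) = (1/2)∫₀^∞ x (1 - F x ^ 2) dx` (as an
unsigned integral, so that the value may a priori be infinite) vanishes if and only if
`X` is degenerate at `0`, i.e. `P(X = 0) = 1`. -/
theorem wncj_eq_zero_iff_degenerate
    {Ω : Type*} [MeasurableSpace Ω] (μ : Measure Ω) [IsProbabilityMeasure μ]
    (X : Ω → ℝ) (hX : Measurable X) (h0 : ∀ ω, 0 ≤ X ω)
    (F : ℝ → ℝ) (hF : ∀ x, F x = (μ {ω | X ω ≤ x}).toReal) :
    (1 / 2 : ENNReal) * ∫⁻ x in Set.Ioi (0 : ℝ), ENNReal.ofReal (x * (1 - F x ^ 2)) = 0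
      ↔ μ {ω | X ω = 0} = 1 := by
  have hset : MeasurableSet {ω | X ω = 0} := hX (measurableSet_singleton 0)
  have hle : ∀ x, MeasurableSet {ω | X ω ≤ x} := fun x => hX measurableSet_Iic
  have hF0 : ∀ x, 0 ≤ F x := fun x => by rw [hF]; exact ENNReal.toReal_nonneg
  have hF1 : ∀ x, F x = 1 ↔ ∀ᵐ ω ∂μ, X ω ≤ x := fun x => by
    rw [hF, ENNReal.toReal_eq_one_iff]
    exact (prob_compl_eq_zero_iff (hle x)).symm
  have hmono : Monotone F := fun x y hxy => by
    rw [hF, hF]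
    exact ENNReal.toReal_mono (measure_ne_top _ _)
      (measure_mono fun ω (h : X ω ≤ x) => h.trans hxy)
  have hmeas : Measurable fun x => ENNReal.ofReal (x * (1 - F x ^ 2)) :=
    (measurable_id.mul (measurable_const.sub (hmono.measurable.pow_const 2))).ennreal_ofReal
  have hdeg : μ {ω | X ω = 0} = 1 ↔ ∀ᵐ ω ∂μ, X ω = 0 :=
    (prob_compl_eq_zero_iff hset).symm
  rw [hdeg, mul_eq_zero, or_iff_right (by simp), lintegral_eq_zero_iff hmeas]
  constructor
  · intro h
    have hae : ∀ᵐ x : ℝ, x ∈ Set.Ioi (0 : ℝ) → ENNReal.ofReal (x * (1 - F x ^ 2)) = 0 :=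
      (ae_restrict_iff' measurableSet_Ioi).1 h
    have hlim : ∀ n : ℕ, ∀ᵐ ω ∂μ, X ω ≤ 1 / ((n : ℝ) + 1) := fun n => by
      have hpos : (0 : ℝ) < 1 / ((n : ℝ) + 1) := Nat.one_div_pos_of_nat
      obtain ⟨y, hy, hy0, hyn⟩ := (Measure.dense_of_ae hae).exists_between hpos
      have hy1 := ENNReal.ofReal_eq_zero.1 (hy hy0)
      have hFy : F y = 1 := by
        refine le_antisymm ?_ ?_
        · rw [hF]
          exact ENNReal.toReal_le_of_le_ofReal zero_le_one (by simpa using prob_le_one)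
        · by_contra! hlt
          nlinarith [mul_pos hy0 (show 0 < 1 - F y ^ 2 by nlinarith [hF0 y])]
      filter_upwards [(hF1 y).1 hFy] with ω hω using hω.trans hyn.le
    filter_upwards [ae_all_iff.2 hlim] with ω hω
    exact le_antisymm (ge_of_tendsto' tendsto_one_div_add_atTop_nhds_zero_nat hω) (h0 ω)
  · intro h
    refine (ae_restrict_iff' measurableSet_Ioi).2 (ae_of_all _ fun x (hx : 0 < x) => ?_)
    have hFx : F x = 1 := (hF1 x).2 (h.mono fun ω hω => hω.le.trans hx.le)
    simp [hFx]
end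

section
/- Let X be a non-negative random variable with cumulative distribution function F such that P(X ≥ a) = 1 for some a > 0, and suppose the negative cumulative extropy η̄J(X) and the weighted negative cumulative extropy η̄¹J(X) are finite. Then η̄¹J(X) ≥ a·η̄J(X) − a²/4. -/
open MeasureTheory Real

/-- If `g` takes values in `[0, 1]`, then the integral of `(x - a) * g x` over the positive
half-line is at least the integral of `x - a` over `[0, a]`, i.e. `-a ^ 2 / 2`. -/
theorem neg_sq_div_two_le_integral_sub_mul {g : ℝ → ℝ} {a : ℝ} (ha : 0 ≤ a)
    (hg0 : ∀ x, 0 ≤ g x) (hg1 : ∀ x, g x ≤ 1)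
    (hint : IntegrableOn (fun x => (x - a) * g x) (Set.Ioi 0)) :
    -(a ^ 2 / 2) ≤ ∫ x in Set.Ioi (0 : ℝ), (x - a) * g x := by
  have hloc : IntegrableOn (fun x : ℝ => x - a) (Set.Ioc 0 a) :=
    (continuous_id.sub continuous_const).integrableOn_Ioc
  have hval : ∫ x in Set.Ioc (0 : ℝ) a, (x - a) = -(a ^ 2 / 2) := by
    rw [← intervalIntegral.integral_of_le ha,
      intervalIntegral.integral_sub intervalIntegral.intervalIntegrable_id
        intervalIntegrable_const, integral_id, intervalIntegral.integral_const, smul_eq_mul]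
    ring
  have hunion : Set.Ioc 0 a ∪ Set.Ioi a = Set.Ioi 0 := Set.Ioc_union_Ioi_eq_Ioi ha
  rw [← hunion] at hint ⊢
  rw [setIntegral_union (Set.Ioc_disjoint_Ioi le_rfl) measurableSet_Ioi
    hint.left_of_union hint.right_of_union, ← hval]
  have hleft : ∫ x in Set.Ioc (0 : ℝ) a, (x - a) ≤ ∫ x in Set.Ioc (0 : ℝ) a, (x - a) * g x :=
    setIntegral_mono_on hloc hint.left_of_union measurableSet_Ioc fun x hx => by
      nlinarith [hx.2, hg1 x]
  have hright : 0 ≤ ∫ x in Set.Ioi a, (x - a) * g x :=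
    setIntegral_nonneg measurableSet_Ioi fun x hx =>
      mul_nonneg (sub_nonneg.2 (Set.mem_Ioi.1 hx).le) (hg0 x)
  linarith

/-- For a non-negative random variable `X` with cdf `F` such that
`P(X ≥ a) = 1` for some `a > 0`, with finite negative cumulative extropy `η̄J(X)` and
finite weighted negative cumulative extropy `η̄¹J(X)`, one has
`η̄¹J(X) ≥ a η̄J(X) - a²/4`. -/
theorem wncj_ge_of_support_ge
    {Ω : Type*} [MeasurableSpace Ω] (μ : Measure Ω) [IsProbabilityMeasure μ]
    (X : Ω → ℝ) (hX : Measurable X) (h0 : ∀ ω, 0 ≤ X ω)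
    (a : ℝ) (ha : 0 < a) (hsupp : μ {ω | a ≤ X ω} = 1)
    (F : ℝ → ℝ) (hF : ∀ x, F x = (μ {ω | X ω ≤ x}).toReal)
    (hint1 : IntegrableOn (fun x => x * (1 - F x ^ 2)) (Set.Ioi 0))
    (hint2 : IntegrableOn (fun x => 1 - F x ^ 2) (Set.Ioi 0)) :
    (1 / 2) * ∫ x in Set.Ioi (0 : ℝ), x * (1 - F x ^ 2)
      ≥ a * ((1 / 2) * ∫ x in Set.Ioi (0 : ℝ), (1 - F x ^ 2)) - a ^ 2 / 4 := by
  have hF0 (x : ℝ) : 0 ≤ F x := hF x ▸ ENNReal.toReal_nonneg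
  have hF1 (x : ℝ) : F x ≤ 1 := hF x ▸ measureReal_le_one
  have hsplit (x : ℝ) : (x - a) * (1 - F x ^ 2) = x * (1 - F x ^ 2) - a * (1 - F x ^ 2) :=
    sub_mul _ _ _
  have hbound := neg_sq_div_two_le_integral_sub_mul (g := fun x => 1 - F x ^ 2) ha.le
    (fun x => sub_nonneg.2 (pow_le_one₀ (hF0 x) (hF1 x)))
    (fun x => sub_le_self _ (sq_nonneg _))
    (by simp only [hsplit]; exact hint1.sub (hint2.const_mul a))
  simp only [hsplit] at hbound
  rw [integral_sub hint1 (hint2.const_mul a), integral_const_mul] at hbound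
  linarith
end

section
/- Let X be a non-negative absolutely continuous random variable with density f and cumulative distribution function F satisfying F(0) = 0, E(X²) < ∞, and finite weighted negative cumulative extropy η̄¹J(X). Then η̄¹J(X) = (1/4)E(X²) + (1/2)E(X F(X) MIT(X)) − (1/4)E(F(X) SMIT(X)), where MIT(t) = (1/F(t))∫₀^t F(x) dx is the mean inactivity time and SMIT(t) = E[(t − X)² | X ≤ t] = (1/F(t))∫₀^t (t − x)² f(x) dx is the second moment of inactivity time (defined for t with F(t) > 0). -/
open MeasureTheory Real

/-- Mean inactivity time `MIT(t) = (∫₀^t F(x) dx) / F(t)` associated with a cdf `F`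
(defined for `t` with `F t > 0`; Lean's convention `c / 0 = 0` applies otherwise). -/
noncomputable def MIT (F : ℝ → ℝ) (t : ℝ) : ℝ :=
  (∫ x in (0 : ℝ)..t, F x) / F t

/-- Second moment of inactivity time
`SMIT(t) = E[(t - X)² | X ≤ t] = (∫₀^t (t - x)² f(x) dx) / F(t)` for a random variable
with density `f` and cdf `F` (defined for `t` with `F t > 0`). -/
noncomputable def SMIT (f F : ℝ → ℝ) (t : ℝ) : ℝ :=
  (∫ x in (0 : ℝ)..t, (t - x) ^ 2 * f x) / F t

/-- The layer cake formula for the second moment of a non-negative function. -/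
lemma integral_sq_eq_integral_mul_measureReal_lt {α : Type*} [MeasurableSpace α] (P : Measure α)
    [IsProbabilityMeasure P] {Z : α → ℝ} (hZ : Measurable Z) (hZ0 : ∀ᵐ a ∂P, 0 ≤ Z a) :
    ∫ a, Z a ^ 2 ∂P = 2 * ∫ x in Set.Ioi (0 : ℝ), x * P.real {a | x < Z a} := by
  have hmeas : Measurable fun x : ℝ => P.real {a | x < Z a} := by
    refine Antitone.measurable fun x y hxy => ?_
    exact measureReal_mono fun a (ha : y < Z a) => hxy.trans_lt ha
  have key := lintegral_rpow_eq_lintegral_meas_lt_mul P hZ0 hZ.aemeasurable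
    (p := 2) (by norm_num)
  rw [integral_eq_lintegral_of_nonneg_ae (ae_of_all _ fun a => sq_nonneg _)
      (hZ.pow_const 2).aestronglyMeasurable,
    integral_eq_lintegral_of_nonneg_ae _ (by fun_prop)]
  · have hL : ∫⁻ a, ENNReal.ofReal (Z a ^ 2) ∂P = ∫⁻ a, ENNReal.ofReal (Z a ^ (2 : ℝ)) ∂P := by
      simp
    rw [hL, key, ENNReal.toReal_mul, ENNReal.toReal_ofReal (by norm_num)]
    congr 2
    refine setLIntegral_congr_fun measurableSet_Ioi fun x (hx : 0 < x) => ?_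
    have h1 : (2 : ℝ) - 1 = 1 := by norm_num
    simp only [h1, rpow_one]
    rw [ENNReal.ofReal_mul hx.le, ofReal_measureReal, mul_comm]
  · filter_upwards [ae_restrict_mem measurableSet_Ioi] with x (hx : 0 < x)
    exact mul_nonneg hx.le measureReal_nonneg

/-- The second moment of the maximum of two independent copies of a non-negative random
variable with law `ν`. -/
lemma integral_max_sq_prod_self (ν : Measure ℝ) [IsProbabilityMeasure ν]
    (hν : ∀ᵐ y ∂ν, 0 < y) :
    ∫ p, (max p.1 p.2) ^ 2 ∂(ν.prod ν)
      = 2 * ∫ x in Set.Ioi (0 : ℝ), x * (1 - ν.real (Set.Iic x) ^ 2) := by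
  rw [integral_sq_eq_integral_mul_measureReal_lt (ν.prod ν) (measurable_fst.max measurable_snd)]
  · congr 2 with x
    have hset : {p : ℝ × ℝ | x < max p.1 p.2} = (Set.Iic x ×ˢ Set.Iic x)ᶜ := by
      ext p
      simp only [Set.mem_ofPred_eq, Set.mem_compl_iff, Set.mem_prod, Set.mem_Iic, lt_max_iff]
      grind
    rw [hset, probReal_compl_eq_one_sub (measurableSet_Iic.prod measurableSet_Iic),
      measureReal_prod_prod, sq]
  · filter_upwards [Measure.quasiMeasurePreserving_fst.ae hν] with p hp
    exact le_max_of_le_left hp.le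

lemma intervalIntegral_measureReal_Iic (ν : Measure ℝ) [IsProbabilityMeasure ν]
    (hν : ∀ᵐ y ∂ν, 0 < y) {t : ℝ} (ht : 0 ≤ t) :
    ∫ x in (0 : ℝ)..t, ν.real (Set.Iic x) = ∫ y, max (t - y) 0 ∂ν := by
  have hmeas : MeasurableSet {p : ℝ × ℝ | p.2 ≤ p.1} :=
    measurableSet_le measurable_snd measurable_fst
  have hint : Integrable (Function.uncurry fun x y : ℝ =>
      {p : ℝ × ℝ | p.2 ≤ p.1}.indicator (fun _ => (1 : ℝ)) (x, y))
      ((volume.restrict (Set.Ioc 0 t)).prod ν) :=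
    (integrable_const (1 : ℝ)).indicator hmeas
  calc ∫ x in (0 : ℝ)..t, ν.real (Set.Iic x)
      = ∫ x in Set.Ioc 0 t, ∫ y, {p : ℝ × ℝ | p.2 ≤ p.1}.indicator (fun _ => (1 : ℝ)) (x, y) ∂ν := by
        rw [intervalIntegral.integral_of_le ht]
        congr 1 with x
        rw [← integral_indicator_one measurableSet_Iic]
        rfl
    _ = ∫ y, (∫ x in Set.Ioc 0 t,
          {p : ℝ × ℝ | p.2 ≤ p.1}.indicator (fun _ => (1 : ℝ)) (x, y)) ∂ν :=
        integral_integral_swap hint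
    _ = ∫ y, max (t - y) 0 ∂ν := by
        refine integral_congr_ae ?_
        filter_upwards [hν] with y hy
        have h1 : (fun x : ℝ => {p : ℝ × ℝ | p.2 ≤ p.1}.indicator (fun _ => (1 : ℝ)) (x, y))
            = (Set.Ici y).indicator 1 := rfl
        have h2 : Set.Ici y ∩ Set.Ioc 0 t = Set.Icc y t := by
          ext x
          simp only [Set.mem_inter_iff, Set.mem_Ici, Set.mem_Ioc, Set.mem_Icc]
          grind
        rw [h1, integral_indicator_one measurableSet_Ici,
          measureReal_restrict_apply measurableSet_Ici, h2, measureReal_def, Real.volume_Icc,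
          ENNReal.toReal_ofReal']

lemma intervalIntegral_sub_sq_mul_density {ν : Measure ℝ} (hν : ∀ᵐ y ∂ν, 0 < y)
    {f : ℝ → ℝ} (hf : Measurable f) (hf0 : ∀ x, 0 ≤ f x)
    (hdens : ν = volume.withDensity fun x => ENNReal.ofReal (f x)) {t : ℝ} (ht : 0 ≤ t) :
    ∫ x in (0 : ℝ)..t, (t - x) ^ 2 * f x = ∫ y, (max (t - y) 0) ^ 2 ∂ν := by
  have h1 : ∫ x in Set.Ioc 0 t, (t - x) ^ 2 ∂ν = ∫ x in Set.Ioc 0 t, (t - x) ^ 2 * f x := by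
    rw [hdens, setIntegral_withDensity_eq_setIntegral_toReal_smul₀
      hf.ennreal_ofReal.aemeasurable (ae_of_all _ fun _ => ENNReal.ofReal_lt_top) _
      measurableSet_Ioc]
    congr 1 with x
    rw [ENNReal.toReal_ofReal (hf0 x), smul_eq_mul, mul_comm]
  rw [intervalIntegral.integral_of_le ht, ← h1, ← integral_indicator measurableSet_Ioc]
  refine integral_congr_ae ?_
  filter_upwards [hν] with y hy
  by_cases hyt : y ≤ t
  · rw [Set.indicator_of_mem (show y ∈ Set.Ioc 0 t from ⟨hy, hyt⟩),
      max_eq_left (sub_nonneg.2 hyt)]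
  · rw [Set.indicator_of_notMem (fun h => hyt h.2),
      max_eq_right (sub_nonpos.2 (not_le.1 hyt).le), zero_pow two_ne_zero]

lemma mul_MIT (F : ℝ → ℝ) {t : ℝ} (hF : F t = 0 → ∫ x in (0 : ℝ)..t, F x = 0) :
    F t * MIT F t = ∫ x in (0 : ℝ)..t, F x :=
  mul_div_cancel_of_imp' hF

lemma mul_SMIT (f F : ℝ → ℝ) {t : ℝ}
    (hF : F t = 0 → ∫ x in (0 : ℝ)..t, (t - x) ^ 2 * f x = 0) :
    F t * SMIT f F t = ∫ x in (0 : ℝ)..t, (t - x) ^ 2 * f x :=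
  mul_div_cancel_of_imp' hF

lemma integral_max_sq_prod_self_eq_add_sub (ν : Measure ℝ) [IsProbabilityMeasure ν]
    (hν : ∀ᵐ y ∂ν, 0 < y) (h2 : Integrable (fun y => y ^ 2) ν) :
    ∫ p, (max p.1 p.2) ^ 2 ∂(ν.prod ν)
      = (∫ t, t ^ 2 ∂ν) + 2 * (∫ t, t * ∫ y, max (t - y) 0 ∂ν ∂ν)
        - ∫ t, ∫ y, (max (t - y) 0) ^ 2 ∂ν ∂ν := by
  have hpos : ∀ᵐ p ∂(ν.prod ν), 0 < p.1 ∧ 0 < p.2 := by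
    filter_upwards [Measure.quasiMeasurePreserving_fst.ae hν,
      Measure.quasiMeasurePreserving_snd.ae hν] with p h1 h2 using ⟨h1, h2⟩
  have hfst : Integrable (fun p : ℝ × ℝ => p.1 ^ 2) (ν.prod ν) := h2.comp_fst ν
  have hsnd : Integrable (fun p : ℝ × ℝ => p.2 ^ 2) (ν.prod ν) := h2.comp_snd ν
  have hbound : ∀ {t y : ℝ}, 0 < t → 0 < y → 0 ≤ max (t - y) 0 ∧ max (t - y) 0 ≤ t :=
    fun ht hy => ⟨le_max_right _ _, max_le (by linarith) ht.le⟩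
  have hA : Integrable (fun p : ℝ × ℝ => p.1 * max (p.1 - p.2) 0) (ν.prod ν) := by
    refine hfst.mono' (by fun_prop) ?_
    filter_upwards [hpos] with p ⟨h1, h2⟩
    obtain ⟨h3, h4⟩ := hbound h1 h2
    rw [Real.norm_of_nonneg (mul_nonneg h1.le h3)]
    nlinarith
  have hB : Integrable (fun p : ℝ × ℝ => (max (p.1 - p.2) 0) ^ 2) (ν.prod ν) := by
    refine hfst.mono' (by fun_prop) ?_
    filter_upwards [hpos] with p ⟨h1, h2⟩
    obtain ⟨h3, h4⟩ := hbound h1 h2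
    rw [Real.norm_of_nonneg (sq_nonneg _)]
    gcongr
  have hmax : ∀ p : ℝ × ℝ, (max p.1 p.2) ^ 2
      = p.2 ^ 2 + 2 * (p.1 * max (p.1 - p.2) 0) - (max (p.1 - p.2) 0) ^ 2 := by
    intro p
    rcases le_total p.1 p.2 with h | h
    · rw [max_eq_right h, max_eq_right (sub_nonpos.2 h)]; ring
    · rw [max_eq_left h, max_eq_left (sub_nonneg.2 h)]; ring
  simp_rw [hmax]
  rw [integral_sub (by fun_prop) hB, integral_add hsnd (hA.const_mul 2),
    integral_const_mul, integral_prod _ hA, integral_prod _ hB,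
    integral_fun_snd (fun y : ℝ => y ^ 2)]
  simp [integral_const_mul]

/-- For a non-negative absolutely continuous random variable `X` with
density `f` and cdf `F` with `F 0 = 0`, `E(X²) < ∞` and finite weighted negative
cumulative extropy, one has
`η̄¹J(X) = (1/4)E(X²) + (1/2)E(X F(X) MIT(X)) - (1/4)E(F(X) SMIT(X))`. -/
theorem wncj_eq_mit_smit
    {Ω : Type*} [MeasurableSpace Ω] (μ : Measure Ω) [IsProbabilityMeasure μ]
    (X : Ω → ℝ) (hX : Measurable X) (h0 : ∀ ω, 0 ≤ X ω)
    (f : ℝ → ℝ) (hf : Measurable f) (hf0 : ∀ x, 0 ≤ f x)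
    (hdens : Measure.map X μ = volume.withDensity (fun x => ENNReal.ofReal (f x)))
    (F : ℝ → ℝ) (hF : ∀ x, F x = (μ {ω | X ω ≤ x}).toReal)
    (hF0 : F 0 = 0)
    (hX2 : Integrable (fun ω => X ω ^ 2) μ)
    (hint1 : IntegrableOn (fun x => x * (1 - F x ^ 2)) (Set.Ioi 0)) :
    (1 / 2) * ∫ x in Set.Ioi (0 : ℝ), x * (1 - F x ^ 2)
      = (1 / 4) * (∫ ω, X ω ^ 2 ∂μ)
        + (1 / 2) * (∫ ω, X ω * F (X ω) * MIT F (X ω) ∂μ)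
        - (1 / 4) * (∫ ω, F (X ω) * SMIT f F (X ω) ∂μ) := by
  have : IsProbabilityMeasure (μ.map X) := Measure.isProbabilityMeasure_map hX.aemeasurable
  have hcdf : F = fun x => (μ.map X).real (Set.Iic x) := by
    ext x
    rw [hF, map_measureReal_apply hX measurableSet_Iic]
    rfl
  have hpos : ∀ᵐ ω ∂μ, 0 < X ω := by
    have hzero : μ {ω | X ω ≤ 0} = 0 := by
      have h := hF 0
      rw [hF0] at h
      exact (measureReal_eq_zero_iff (μ := μ)).1 h.symm
    simpa [ae_iff] using hzero
  have hν : ∀ᵐ y ∂(μ.map X), 0 < y :=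
    (ae_map_iff hX.aemeasurable measurableSet_Ioi).2 hpos
  have h2 : Integrable (fun y => y ^ 2) (μ.map X) :=
    (integrable_map_measure (by fun_prop) hX.aemeasurable).2 hX2
  have hmono : Monotone F := by
    intro x y hxy
    simp only [hcdf]
    exact measureReal_mono (Set.Iic_subset_Iic.2 hxy)
  have hM : ∀ t, 0 ≤ t → F t * MIT F t = ∫ y, max (t - y) 0 ∂(μ.map X) := by
    intro t ht
    have hI : ∫ x in (0 : ℝ)..t, F x = ∫ y, max (t - y) 0 ∂(μ.map X) := by
      rw [hcdf]
      exact intervalIntegral_measureReal_Iic _ hν ht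
    rw [← hI]
    refine mul_MIT F fun hFt => ?_
    rw [intervalIntegral.integral_of_le ht]
    refine setIntegral_eq_zero_of_forall_eq_zero fun x hx => le_antisymm ?_ ?_
    · exact (hmono hx.2).trans hFt.le
    · exact hF0.ge.trans (hmono hx.1.le)
  have hS : ∀ t, 0 ≤ t → F t * SMIT f F t = ∫ y, (max (t - y) 0) ^ 2 ∂(μ.map X) := by
    intro t ht
    have hI := intervalIntegral_sub_sq_mul_density hν hf hf0 hdens ht
    rw [← hI]
    refine mul_SMIT f F fun hFt => hI.trans (integral_eq_zero_of_ae ?_)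
    have hgt : ∀ᵐ y ∂(μ.map X), t < y := by
      have hnull : (μ.map X) (Set.Iic t) = 0 := by
        rw [hcdf] at hFt
        exact (measureReal_eq_zero_iff).1 hFt
      rw [ae_iff]
      simpa [Set.Iic] using hnull
    filter_upwards [hgt] with y hy
    simp [max_eq_right (sub_nonpos.2 hy.le)]
  have e1 : ∫ ω, X ω ^ 2 ∂μ = ∫ t, t ^ 2 ∂(μ.map X) :=
    (integral_map (f := fun t : ℝ => t ^ 2) hX.aemeasurable (by fun_prop)).symm
  have e2 : ∫ ω, X ω * F (X ω) * MIT F (X ω) ∂μ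
      = ∫ t, t * ∫ y, max (t - y) 0 ∂(μ.map X) ∂(μ.map X) := by
    rw [integral_map (f := fun t => t * ∫ y, max (t - y) 0 ∂(μ.map X)) hX.aemeasurable]
    · congr 1 with ω
      rw [mul_assoc, hM _ (h0 ω)]
    · exact aestronglyMeasurable_id.mul (StronglyMeasurable.integral_prod_right
        (f := fun t y : ℝ => max (t - y) 0) (by fun_prop)).aestronglyMeasurable
  have e3 : ∫ ω, F (X ω) * SMIT f F (X ω) ∂μ
      = ∫ t, ∫ y, (max (t - y) 0) ^ 2 ∂(μ.map X) ∂(μ.map X) := by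
    rw [integral_map (f := fun t => ∫ y, (max (t - y) 0) ^ 2 ∂(μ.map X)) hX.aemeasurable]
    · congr 1 with ω
      rw [hS _ (h0 ω)]
    · exact (StronglyMeasurable.integral_prod_right
        (f := fun t y : ℝ => (max (t - y) 0) ^ 2) (by fun_prop)).aestronglyMeasurable
  have hL : ∫ x in Set.Ioi (0 : ℝ), x * (1 - F x ^ 2)
      = ∫ x in Set.Ioi (0 : ℝ), x * (1 - (μ.map X).real (Set.Iic x) ^ 2) := by
    rw [hcdf]
  rw [e1, e2, e3, hL]
  linarith [integral_max_sq_prod_self (μ.map X) hν,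
    integral_max_sq_prod_self_eq_add_sub (μ.map X) hν h2]
end

section
/- Let X be a non-negative random variable with continuous cumulative distribution function F and E(X²) < ∞, and define the cumulative hazard Λ(x) = −log(1 − F(x)) (with Λ(x) = +∞ where F(x) = 1) and S(t) = ∫₀^t x Λ(x) dx. Then the weighted negative cumulative extropy satisfies η̄¹J(X) ≤ (1/4)E(X²) + (1/2)E(S(X)). -/
open MeasureTheory Real

/-- Cumulative hazard `Λ(x) = -log(1 - F(x))`, with value `+∞` where `F(x) = 1`. -/
noncomputable def cumHazard (F : ℝ → ℝ) (x : ℝ) : ENNReal :=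
  if F x < 1 then ENNReal.ofReal (-Real.log (1 - F x)) else ⊤

/-- `S(t) = ∫₀^t x Λ(x) dx` (as an unsigned integral, since `Λ` may be infinite). -/
noncomputable def cumHazardS (F : ℝ → ℝ) (t : ℝ) : ENNReal :=
  ∫⁻ x in Set.Ioc (0 : ℝ) t, ENNReal.ofReal x * cumHazard F x

/-- Layer-cake inequality for a non-negative unsigned weight: integrating the weight against the
tail `P(X > x)` is at most the expectation of its primitive evaluated at `X`. -/
lemma lintegral_mul_tail_le {Ω : Type*} [MeasurableSpace Ω] (μ : Measure Ω) [SFinite μ]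
    {X : Ω → ℝ} (hX : Measurable X) {g : ℝ → ENNReal} (hg : Measurable g) :
    ∫⁻ x in Set.Ioi (0 : ℝ), g x * μ {ω | x < X ω}
      ≤ ∫⁻ ω, (∫⁻ x in Set.Ioc (0 : ℝ) (X ω), g x) ∂μ := by
  have hmeas : MeasurableSet {p : Ω × ℝ | p.2 ≤ X p.1} :=
    measurableSet_le measurable_snd (hX.comp measurable_fst)
  have key : ∀ ω, ∫⁻ x in Set.Ioc (0 : ℝ) (X ω), g x
      = ∫⁻ x in Set.Ioi (0 : ℝ), {p : Ω × ℝ | p.2 ≤ X p.1}.indicator (fun p => g p.2) (ω, x) := by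
    intro ω
    have : (fun x => {p : Ω × ℝ | p.2 ≤ X p.1}.indicator (fun p => g p.2) (ω, x))
        = (Set.Iic (X ω)).indicator g := by
      ext x
      simp [Set.indicator_apply]
    rw [this, lintegral_indicator measurableSet_Iic, Measure.restrict_restrict measurableSet_Iic,
      Set.inter_comm, Set.Ioi_inter_Iic]
  simp_rw [key]
  rw [lintegral_lintegral_swap
    (f := fun ω x => {p : Ω × ℝ | p.2 ≤ X p.1}.indicator (fun p => g p.2) (ω, x)) (((hg.comp measurable_snd).indicator hmeas).aemeasurable)]
  refine lintegral_mono fun x => ?_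
  have hx : MeasurableSet {ω | x ≤ X ω} := measurableSet_le measurable_const hX
  have : (fun ω => {p : Ω × ℝ | p.2 ≤ X p.1}.indicator (fun p => g p.2) (ω, x))
      = {ω | x ≤ X ω}.indicator (fun _ => g x) := by
    ext ω
    simp [Set.indicator_apply]
  rw [this, lintegral_indicator_const hx]
  gcongr
  exact fun h => le_of_lt h

/-- The primitive of the identity on `(0, t]`, as an unsigned integral. -/
lemma lintegral_Ioc_ofReal_id {t : ℝ} (ht : 0 ≤ t) :
    ∫⁻ x in Set.Ioc (0 : ℝ) t, ENNReal.ofReal x = ENNReal.ofReal (t ^ 2 / 2) := by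
  have hint : IntegrableOn (fun x : ℝ => x) (Set.Ioc 0 t) :=
    continuous_id.integrableOn_Ioc
  have hnonneg : 0 ≤ᵐ[volume.restrict (Set.Ioc 0 t)] fun x : ℝ => x := by
    filter_upwards [ae_restrict_mem measurableSet_Ioc] with x hx using hx.1.le
  rw [← ofReal_integral_eq_lintegral_ofReal hint hnonneg,
    ← intervalIntegral.integral_of_le ht, integral_id]
  simp

/-- The cumulative hazard of a measurable function is measurable. -/
lemma measurable_cumHazard {F : ℝ → ℝ} (hF : Measurable F) : Measurable (cumHazard F) :=
  Measurable.ite (measurableSet_lt hF measurable_const)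
    (measurable_log.comp (measurable_const.sub hF)).neg.ennreal_ofReal measurable_const

/-- The pointwise bound `x (1 - F²) ≤ x (1 - F) + x Λ (1 - F)`, from `F ≤ -log (1 - F)`. -/
lemma ofReal_mul_one_sub_sq_le (F : ℝ → ℝ) {x : ℝ} (hx : 0 ≤ x) (h0 : 0 ≤ F x) (h1 : F x ≤ 1) :
    ENNReal.ofReal (x * (1 - F x ^ 2))
      ≤ ENNReal.ofReal x * ENNReal.ofReal (1 - F x)
        + ENNReal.ofReal x * cumHazard F x * ENNReal.ofReal (1 - F x) := by
  rcases h1.lt_or_eq with h | h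
  · have hlog : F x ≤ -Real.log (1 - F x) := by
      linarith [Real.log_le_sub_one_of_pos (sub_pos.2 h)]
    have hpos : 0 ≤ 1 - F x := by linarith
    have hL : 0 ≤ -Real.log (1 - F x) := h0.trans hlog
    rw [cumHazard, if_pos h, ← ENNReal.ofReal_mul hx, ← ENNReal.ofReal_mul hx,
      ← ENNReal.ofReal_mul (mul_nonneg hx hL), ← ENNReal.ofReal_add (by positivity)
        (mul_nonneg (mul_nonneg hx hL) hpos)]
    refine ENNReal.ofReal_le_ofReal ?_
    nlinarith [mul_le_mul_of_nonneg_left hlog (mul_nonneg hx hpos)]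
  · simp [h]

/-- For a non-negative random variable `X` with continuous cdf `F` and
`E(X²) < ∞`, with `Λ(x) = -log(1 - F x)` (equal to `+∞` where `F x = 1`) and
`S(t) = ∫₀^t x Λ(x) dx`, the weighted negative cumulative extropy satisfies
`η̄¹J(X) ≤ (1/4)E(X²) + (1/2)E(S(X))`. -/
theorem wncj_le_hazard_bound
    {Ω : Type*} [MeasurableSpace Ω] (μ : Measure Ω) [IsProbabilityMeasure μ]
    (X : Ω → ℝ) (hX : Measurable X) (h0 : ∀ ω, 0 ≤ X ω)
    (F : ℝ → ℝ) (hF : ∀ x, F x = (μ {ω | X ω ≤ x}).toReal)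
    (hFcont : Continuous F)
    (hX2 : Integrable (fun ω => X ω ^ 2) μ) :
    (1 / 2 : ENNReal) * ∫⁻ x in Set.Ioi (0 : ℝ), ENNReal.ofReal (x * (1 - F x ^ 2))
      ≤ (1 / 4 : ENNReal) * (∫⁻ ω, ENNReal.ofReal (X ω ^ 2) ∂μ)
        + (1 / 2 : ENNReal) * (∫⁻ ω, cumHazardS F (X ω) ∂μ) := by
  have htail : ∀ x, μ {ω | x < X ω} = ENNReal.ofReal (1 - F x) := by
    intro x
    have hc : {ω | x < X ω} = {ω | X ω ≤ x}ᶜ := by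
      ext ω
      simp
    rw [hc, prob_compl_eq_one_sub (measurableSet_le hX measurable_const), hF,
      ENNReal.ofReal_sub _ ENNReal.toReal_nonneg, ENNReal.ofReal_toReal (measure_ne_top _ _),
      ENNReal.ofReal_one]
  have hF0 : ∀ x, 0 ≤ F x := fun x => hF x ▸ ENNReal.toReal_nonneg
  have hF1 : ∀ x, F x ≤ 1 := fun x => hF x ▸ measureReal_le_one
  have hid : Measurable ENNReal.ofReal := ENNReal.measurable_ofReal
  have hΛ : Measurable fun x => ENNReal.ofReal x * cumHazard F x :=
    hid.mul (measurable_cumHazard hFcont.measurable)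
  have hmoment := lintegral_mul_tail_le μ hX hid
  have hhazard := lintegral_mul_tail_le μ hX hΛ
  simp_rw [htail] at hmoment hhazard
  have hsq : ∫⁻ ω, (∫⁻ x in Set.Ioc (0 : ℝ) (X ω), ENNReal.ofReal x) ∂μ
      = (1 / 2 : ENNReal) * ∫⁻ ω, ENNReal.ofReal (X ω ^ 2) ∂μ := by
    rw [← lintegral_const_mul _ (hX.pow_const 2).ennreal_ofReal]
    refine lintegral_congr fun ω => ?_
    rw [lintegral_Ioc_ofReal_id (h0 ω), ENNReal.ofReal_div_of_pos two_pos, ENNReal.ofReal_ofNat,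
      div_eq_mul_inv, one_div, mul_comm]
  have hquarter : (1 / 4 : ENNReal) = 1 / 2 * (1 / 2) := by
    rw [one_div, one_div, ← ENNReal.mul_inv (by simp) (by simp)]
    norm_num
  rw [hquarter, mul_assoc, ← hsq, ← mul_add]
  gcongr
  calc ∫⁻ x in Set.Ioi (0 : ℝ), ENNReal.ofReal (x * (1 - F x ^ 2))
      ≤ ∫⁻ x in Set.Ioi (0 : ℝ), (ENNReal.ofReal x * ENNReal.ofReal (1 - F x)
          + ENNReal.ofReal x * cumHazard F x * ENNReal.ofReal (1 - F x)) :=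
        setLIntegral_mono' measurableSet_Ioi fun x hx =>
          ofReal_mul_one_sub_sq_le F (le_of_lt hx) (hF0 x) (hF1 x)
    _ = (∫⁻ x in Set.Ioi (0 : ℝ), ENNReal.ofReal x * ENNReal.ofReal (1 - F x))
          + ∫⁻ x in Set.Ioi (0 : ℝ),
              ENNReal.ofReal x * cumHazard F x * ENNReal.ofReal (1 - F x) :=
        lintegral_add_left
          (hid.mul (measurable_const.sub hFcont.measurable).ennreal_ofReal) _
    _ ≤ _ := add_le_add hmoment hhazard
end

section
/- Let X be a non-negative random variable with cumulative distribution function F, let q : [0,1] → [0,1] be a distortion function, and let T be a non-negative random variable whose cumulative distribution function satisfies F_T(x) = q(F(x)) for all x ≥ 0. If φ(q(u)) ≥ φ(u) for all 0 < u < 1, where φ(u) = (1 − u²)/2, then η̄¹J(T) ≥ η̄¹J(X); if instead φ(q(u)) ≤ φ(u) for all 0 < u < 1, then η̄¹J(T) ≤ η̄¹J(X). -/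
open MeasureTheory Real

/-- Let `T` have cdf `F_T = q ∘ F` where `F` is the cdf of a non-negative
random variable `X` and `q` is a distortion function. With `φ(u) = (1-u²)/2`: if
`φ(q u) ≥ φ u` on `(0,1)` then `η̄¹J(T) ≥ η̄¹J(X)`, and if `φ(q u) ≤ φ u` on `(0,1)`
then `η̄¹J(T) ≤ η̄¹J(X)` (phrased with unsigned integrals, the quantities being possibly
infinite). -/
theorem wncj_distortion_comparison
    {Ω : Type*} [MeasurableSpace Ω] (μ : Measure Ω) [IsProbabilityMeasure μ]
    (X T : Ω → ℝ) (hX : Measurable X) (hT : Measurable T)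
    (h0 : ∀ ω, 0 ≤ X ω) (h0T : ∀ ω, 0 ≤ T ω)
    (F FT : ℝ → ℝ)
    (hF : ∀ x, F x = (μ {ω | X ω ≤ x}).toReal)
    (hFT : ∀ x, FT x = (μ {ω | T ω ≤ x}).toReal)
    (q : ℝ → ℝ)
    (hq_cont : ContinuousOn q (Set.Icc 0 1))
    (hq_mono : MonotoneOn q (Set.Icc 0 1))
    (hq_maps : ∀ u ∈ Set.Icc (0 : ℝ) 1, q u ∈ Set.Icc (0 : ℝ) 1)
    (hq0 : q 0 = 0) (hq1 : q 1 = 1)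
    (hdist : ∀ x : ℝ, 0 ≤ x → FT x = q (F x)) :
    ((∀ u ∈ Set.Ioo (0 : ℝ) 1, (1 - u ^ 2) / 2 ≤ (1 - q u ^ 2) / 2) →
      (∫⁻ x in Set.Ioi (0 : ℝ), ENNReal.ofReal (x * ((1 - F x ^ 2) / 2)))
        ≤ ∫⁻ x in Set.Ioi (0 : ℝ), ENNReal.ofReal (x * ((1 - FT x ^ 2) / 2)))
    ∧
    ((∀ u ∈ Set.Ioo (0 : ℝ) 1, (1 - q u ^ 2) / 2 ≤ (1 - u ^ 2) / 2) →
      (∫⁻ x in Set.Ioi (0 : ℝ), ENNReal.ofReal (x * ((1 - FT x ^ 2) / 2)))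
        ≤ ∫⁻ x in Set.Ioi (0 : ℝ), ENNReal.ofReal (x * ((1 - F x ^ 2) / 2))) := by
  have hmem : ∀ x, F x ∈ Set.Icc (0 : ℝ) 1 := fun x => by
    rw [hF]
    exact ⟨ENNReal.toReal_nonneg, measureReal_le_one⟩
  have endpoints : ∀ x, F x = 0 ∨ F x = 1 ∨ F x ∈ Set.Ioo (0 : ℝ) 1 := fun x => by
    rcases (hmem x).1.eq_or_lt with h | h
    · exact .inl h.symm
    · rcases (hmem x).2.eq_or_lt with h' | h'
      · exact .inr (.inl h')
      · exact .inr (.inr ⟨h, h'⟩)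
  constructor <;> intro h <;> refine setLIntegral_mono' measurableSet_Ioi fun x hx => ?_ <;>
    refine ENNReal.ofReal_le_ofReal (mul_le_mul_of_nonneg_left ?_ (le_of_lt hx)) <;>
    rw [hdist x (le_of_lt hx)] <;>
    rcases endpoints x with h0 | h1 | hu
  · rw [h0, hq0]
  · rw [h1, hq1]
  · exact h _ hu
  · rw [h0, hq0]
  · rw [h1, hq1]
  · exact h _ hu
end

section
/- Let X be a non-negative absolutely continuous random variable with cumulative distribution function F and density f that is positive on the interval (0, b) (0 < b ≤ ∞) and zero outside it, and suppose there are constants 0 < m ≤ M < ∞ with m·x ≤ f(x) ≤ M·x for all x ∈ (0, b). Let q : [0,1] → [0,1] be a distortion function and T a non-negative random variable with F_T(x) = q(F(x)) for all x ≥ 0. Then I_q/M ≤ η̄¹J(T) ≤ I_q/m, where I_q = ∫₀¹ φ(q(u)) du and φ(u) = (1 − u²)/2. -/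
open MeasureTheory Real

open ProbabilityTheory Filter Topology Set in
/-- The distribution function of an atomless measure on the real line is continuous. -/
theorem continuous_cdf_of_nullSingleton (ν : Measure ℝ) [IsProbabilityMeasure ν] [NullSingletonClass ν] :
    Continuous (cdf ν) := by
  refine continuous_iff_continuousAt.2 fun x => ?_
  rw [(monotone_cdf ν).continuousAt_iff_leftLim_eq_rightLim, StieltjesFunction.rightLim_eq]
  refine le_antisymm ((monotone_cdf ν).leftLim_le le_rfl) ?_
  have h := (cdf ν).measure_singleton x
  rw [measure_cdf, measure_singleton] at h
  exact sub_nonpos.1 (ENNReal.ofReal_eq_zero.1 h.symm)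

open ProbabilityTheory Filter Topology Set in
/-- The probability integral transform: an atomless law on the real line is pushed forward
to the uniform law on `(0, 1]` by its distribution function. -/
theorem map_cdf_eq_uniform (ν : Measure ℝ) [IsProbabilityMeasure ν] [NullSingletonClass ν] :
    Measure.map (cdf ν) ν = volume.restrict (Ioc (0 : ℝ) 1) := by
  have hcont := continuous_cdf_of_nullSingleton ν
  have : IsProbabilityMeasure (Measure.map (cdf ν) ν) :=
    Measure.isProbabilityMeasure_map hcont.measurable.aemeasurable
  refine Measure.ext_of_Iic _ _ fun u => ?_
  rw [Measure.map_apply hcont.measurable measurableSet_Iic,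
    Measure.restrict_apply measurableSet_Iic, inter_comm, Ioc_inter_Iic, Real.volume_Ioc, sub_zero]
  rcases lt_or_ge u 0 with hu0 | hu0
  · have : (cdf ν) ⁻¹' Iic u = ∅ :=
      eq_empty_of_forall_notMem fun x hx => absurd (cdf_nonneg ν x) (not_le.2 (lt_of_le_of_lt hx hu0))
    rw [this, measure_empty, ENNReal.ofReal_of_nonpos ((min_le_right _ _).trans hu0.le)]
  rcases le_or_gt 1 u with hu1 | hu1
  · have : (cdf ν) ⁻¹' Iic u = univ :=
      eq_univ_of_forall fun x => (cdf_le_one ν x).trans hu1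
    rw [this, measure_univ, min_eq_left hu1, ENNReal.ofReal_one]
  rw [min_eq_right hu1.le]
  rcases ((cdf ν) ⁻¹' Iic u).eq_empty_or_nonempty with hS | hS
  · have hu : u ≤ 0 := ge_of_tendsto (tendsto_cdf_atBot ν) <| Eventually.of_forall fun x => by
      have hx : x ∉ (cdf ν) ⁻¹' Iic u := hS ▸ notMem_empty x
      exact (not_le.1 hx).le
    rw [hS, measure_empty, ENNReal.ofReal_of_nonpos hu]
  obtain ⟨y, hy⟩ := ((tendsto_cdf_atTop ν).eventually_const_lt hu1).exists
  have hbdd : BddAbove ((cdf ν) ⁻¹' Iic u) :=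
    ⟨y, fun x hx => le_of_not_gt fun hlt =>
      absurd (hy.trans_le (monotone_cdf ν hlt.le)) (not_lt.2 hx)⟩
  set c := sSup ((cdf ν) ⁻¹' Iic u) with hc
  have hcmem : cdf ν c ≤ u := (isClosed_Iic.preimage hcont).csSup_mem hS hbdd
  have hcu : cdf ν c = u := by
    refine le_antisymm hcmem ?_
    refine ge_of_tendsto (hcont.continuousWithinAt (s := Ioi c) (x := c)) ?_
    filter_upwards [self_mem_nhdsWithin] with x hx
    exact le_of_not_ge fun h => absurd (le_csSup hbdd h) (not_le.2 hx)
  have hSc : (cdf ν) ⁻¹' Iic u = Iic c := by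
    ext x
    exact ⟨fun hx => le_csSup hbdd hx, fun hx => (monotone_cdf ν hx).trans hcmem⟩
  rw [hSc, ← ofReal_cdf, hcu]

/-- Let `X` be a non-negative absolutely continuous random variable with
cdf `F` and density `f` positive on `(0, b)` (`0 < b ≤ ∞`) and zero outside it, with
`mlo·x ≤ f x ≤ Mhi·x` on `(0, b)` for constants `0 < mlo ≤ Mhi < ∞`. If `T` has cdf
`F_T = q ∘ F` for a distortion function `q`, then `I_q/Mhi ≤ η̄¹J(T) ≤ I_q/mlo`, where
`I_q = ∫₀¹ φ(q u) du` and `φ(u) = (1-u²)/2`. -/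
theorem wncj_distortion_density_bounds
    {Ω : Type*} [MeasurableSpace Ω] (μ : Measure Ω) [IsProbabilityMeasure μ]
    (X T : Ω → ℝ) (hX : Measurable X) (hT : Measurable T)
    (h0 : ∀ ω, 0 ≤ X ω) (h0T : ∀ ω, 0 ≤ T ω)
    (f : ℝ → ℝ) (hf : Measurable f) (hf0 : ∀ x, 0 ≤ f x)
    (hdens : Measure.map X μ = volume.withDensity (fun x => ENNReal.ofReal (f x)))
    (b : ENNReal) (hb : 0 < b)
    (hf_pos : ∀ x : ℝ, 0 < x → ENNReal.ofReal x < b → 0 < f x)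
    (hf_zero : ∀ x : ℝ, x ≤ 0 ∨ b ≤ ENNReal.ofReal x → f x = 0)
    (mlo Mhi : ℝ) (hmlo : 0 < mlo) (hmM : mlo ≤ Mhi)
    (hbound : ∀ x : ℝ, 0 < x → ENNReal.ofReal x < b → mlo * x ≤ f x ∧ f x ≤ Mhi * x)
    (F FT : ℝ → ℝ)
    (hF : ∀ x, F x = (μ {ω | X ω ≤ x}).toReal)
    (hFT : ∀ x, FT x = (μ {ω | T ω ≤ x}).toReal)
    (q : ℝ → ℝ)
    (hq_cont : ContinuousOn q (Set.Icc 0 1))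
    (hq_mono : MonotoneOn q (Set.Icc 0 1))
    (hq_maps : ∀ u ∈ Set.Icc (0 : ℝ) 1, q u ∈ Set.Icc (0 : ℝ) 1)
    (hq0 : q 0 = 0) (hq1 : q 1 = 1)
    (hdist : ∀ x : ℝ, 0 ≤ x → FT x = q (F x)) :
    (∫ u in (0 : ℝ)..1, (1 - q u ^ 2) / 2) / Mhi
      ≤ (∫ x in Set.Ioi (0 : ℝ), x * ((1 - FT x ^ 2) / 2))
    ∧ (∫ x in Set.Ioi (0 : ℝ), x * ((1 - FT x ^ 2) / 2))
      ≤ (∫ u in (0 : ℝ)..1, (1 - q u ^ 2) / 2) / mlo := by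
  set ν := Measure.map X μ with hν
  have : IsProbabilityMeasure ν := Measure.isProbabilityMeasure_map hX.aemeasurable
  have : NullSingletonClass ν := by rw [hdens]; infer_instance
  have hM : 0 < Mhi := hmlo.trans_le hmM
  have hFcdf : ∀ x, F x = ProbabilityTheory.cdf ν x := fun x => by
    rw [hF, ProbabilityTheory.cdf_eq_real, measureReal_def, hν, Measure.map_apply hX measurableSet_Iic]
    rfl
  have hFmem : ∀ x, F x ∈ Set.Icc (0 : ℝ) 1 := fun x => by
    rw [hFcdf]; exact ⟨ProbabilityTheory.cdf_nonneg ν x, ProbabilityTheory.cdf_le_one ν x⟩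
  have hFmono : Monotone F := fun x y h => by
    simpa only [hFcdf] using ProbabilityTheory.monotone_cdf ν h
  have hqFmono : Monotone fun x => q (F x) :=
    fun x y h => hq_mono (hFmem x) (hFmem y) (hFmono h)
  set φ : ℝ → ℝ := fun x => (1 - q (F x) ^ 2) / 2 with hφ
  have hφ_meas : Measurable φ :=
    ((measurable_const.sub (hqFmono.measurable.pow_const 2))).div_const 2
  have hφ_nonneg : ∀ x, 0 ≤ φ x := fun x => by
    have h := hq_maps _ (hFmem x)
    simp only [hφ]
    nlinarith [h.1, h.2]
  have hφ_le : ∀ x, φ x ≤ 1 := fun x => by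
    simp only [hφ]
    nlinarith [sq_nonneg (q (F x))]
  have hF_one : ∀ x, b ≤ ENNReal.ofReal x → F x = 1 := fun x hx => by
    have hIoi : ν (Set.Ioi x) = 0 := by
      rw [hdens, withDensity_apply _ measurableSet_Ioi]
      refine (setLIntegral_congr_fun measurableSet_Ioi fun y hy => ?_).trans (lintegral_zero)
      rw [hf_zero y (Or.inr (hx.trans (ENNReal.ofReal_le_ofReal (le_of_lt hy)))),
        ENNReal.ofReal_zero]
    have hIic : ν (Set.Iic x) = 1 := by
      rw [← Set.compl_Ioi, prob_compl_eq_one_iff measurableSet_Ioi, hIoi]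
    rw [hFcdf, ProbabilityTheory.cdf_eq_real, measureReal_def, hIic, ENNReal.toReal_one]
  have hφ_zero : ∀ x, b ≤ ENNReal.ofReal x → φ x = 0 := fun x hx => by
    simp [hφ, hF_one x hx, hq1]
  have hf_int : Integrable f := by
    refine ⟨hf.aestronglyMeasurable, ?_⟩
    rw [hasFiniteIntegral_iff_ofReal (Filter.Eventually.of_forall hf0),
      ← setLIntegral_univ, ← withDensity_apply _ MeasurableSet.univ, ← hdens]
    exact measure_lt_top _ _
  have hfφ_int : Integrable fun x => f x * φ x := by
    refine hf_int.mono (hf.mul hφ_meas).aestronglyMeasurable (Filter.Eventually.of_forall fun x => ?_)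
    rw [Real.norm_of_nonneg (mul_nonneg (hf0 x) (hφ_nonneg x)), Real.norm_of_nonneg (hf0 x)]
    exact mul_le_of_le_one_right (hf0 x) (hφ_le x)
  have hI : ∫ u in (0 : ℝ)..1, (1 - q u ^ 2) / 2 = ∫ x in Set.Ioi (0 : ℝ), f x * φ x := by
    have hsm : AEStronglyMeasurable (fun u => (1 - q u ^ 2) / 2) (Measure.map (ProbabilityTheory.cdf ν) ν) := by
      rw [map_cdf_eq_uniform]
      refine ContinuousOn.aestronglyMeasurable ?_ measurableSet_Ioc
      have := hq_cont.mono Set.Ioc_subset_Icc_self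
      fun_prop
    rw [intervalIntegral.integral_of_le zero_le_one, ← map_cdf_eq_uniform ν,
      integral_map (ProbabilityTheory.monotone_cdf ν).measurable.aemeasurable hsm]
    simp only [← hFcdf]
    rw [hdens, integral_withDensity_eq_integral_toReal_smul hf.ennreal_ofReal
      (Filter.Eventually.of_forall fun _ => ENNReal.ofReal_lt_top),
      setIntegral_eq_integral_of_forall_compl_eq_zero]
    · simp only [ENNReal.toReal_ofReal (hf0 _), smul_eq_mul, hφ]
    · intro x hx
      rw [hf_zero x (Or.inl (not_lt.1 hx)), zero_mul]
  have hJ : ∫ x in Set.Ioi (0 : ℝ), x * ((1 - FT x ^ 2) / 2)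
      = ∫ x in Set.Ioi (0 : ℝ), x * φ x :=
    setIntegral_congr_fun measurableSet_Ioi fun x hx => by
      simp only [hφ, hdist x (le_of_lt hx)]
  have hlow : ∀ x ∈ Set.Ioi (0 : ℝ), f x * φ x / Mhi ≤ x * φ x := fun x hx => by
    rcases lt_or_ge (ENNReal.ofReal x) b with hxb | hxb
    · rw [div_le_iff₀ hM]
      nlinarith [mul_le_mul_of_nonneg_right (hbound x hx hxb).2 (hφ_nonneg x)]
    · simp [hφ_zero x hxb]
  have hupp : ∀ x ∈ Set.Ioi (0 : ℝ), x * φ x ≤ f x * φ x / mlo := fun x hx => by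
    rcases lt_or_ge (ENNReal.ofReal x) b with hxb | hxb
    · rw [le_div_iff₀ hmlo]
      nlinarith [mul_le_mul_of_nonneg_right (hbound x hx hxb).1 (hφ_nonneg x)]
    · simp [hφ_zero x hxb]
  have hxφ_int : IntegrableOn (fun x => x * φ x) (Set.Ioi 0) := by
    refine Integrable.mono' (hfφ_int.integrableOn.div_const mlo)
      (measurable_id.mul hφ_meas).aestronglyMeasurable
      (ae_restrict_of_forall_mem measurableSet_Ioi fun x hx => ?_)
    rw [Real.norm_of_nonneg (mul_nonneg (le_of_lt hx) (hφ_nonneg x))]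
    exact hupp x hx
  rw [hI, hJ, ← integral_div, ← integral_div]
  exact ⟨setIntegral_mono_on (hfφ_int.integrableOn.div_const Mhi) hxφ_int measurableSet_Ioi hlow,
    setIntegral_mono_on hxφ_int (hfφ_int.integrableOn.div_const mlo) measurableSet_Ioi hupp⟩
end

section
/- Let X be a non-negative random variable with cumulative distribution function F and finite weighted negative cumulative extropy η̄¹J(X), let q : [0,1] → [0,1] be a distortion function, and let T be a non-negative random variable with F_T(x) = q(F(x)) for all x ≥ 0. If B₁ and B₂ are constants with 0 ≤ B₁ and B₁·φ(u) ≤ φ(q(u)) ≤ B₂·φ(u) for all u ∈ [0,1), where φ(u) = (1 − u²)/2, then B₁·η̄¹J(X) ≤ η̄¹J(T) ≤ B₂·η̄¹J(X). -/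
open MeasureTheory Real

/-- Let `X` be a non-negative random variable with cdf `F` and finite
weighted negative cumulative extropy, and let `T` have cdf `F_T = q ∘ F` for a
distortion function `q`. If `0 ≤ B₁` and `B₁ φ(u) ≤ φ(q u) ≤ B₂ φ(u)` for all
`u ∈ [0,1)`, where `φ(u) = (1-u²)/2`, then `B₁ η̄¹J(X) ≤ η̄¹J(T) ≤ B₂ η̄¹J(X)`. -/
theorem wncj_distortion_phi_ratio_bounds
    {Ω : Type*} [MeasurableSpace Ω] (μ : Measure Ω) [IsProbabilityMeasure μ]
    (X T : Ω → ℝ) (hX : Measurable X) (hT : Measurable T)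
    (h0 : ∀ ω, 0 ≤ X ω) (h0T : ∀ ω, 0 ≤ T ω)
    (F FT : ℝ → ℝ)
    (hF : ∀ x, F x = (μ {ω | X ω ≤ x}).toReal)
    (hFT : ∀ x, FT x = (μ {ω | T ω ≤ x}).toReal)
    (hint : IntegrableOn (fun x => x * ((1 - F x ^ 2) / 2)) (Set.Ioi 0))
    (q : ℝ → ℝ)
    (hq_cont : ContinuousOn q (Set.Icc 0 1))
    (hq_mono : MonotoneOn q (Set.Icc 0 1))
    (hq_maps : ∀ u ∈ Set.Icc (0 : ℝ) 1, q u ∈ Set.Icc (0 : ℝ) 1)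
    (hq0 : q 0 = 0) (hq1 : q 1 = 1)
    (hdist : ∀ x : ℝ, 0 ≤ x → FT x = q (F x))
    (B₁ B₂ : ℝ) (hB₁ : 0 ≤ B₁)
    (hratio : ∀ u ∈ Set.Ico (0 : ℝ) 1,
      B₁ * ((1 - u ^ 2) / 2) ≤ (1 - q u ^ 2) / 2 ∧
        (1 - q u ^ 2) / 2 ≤ B₂ * ((1 - u ^ 2) / 2)) :
    B₁ * (∫ x in Set.Ioi (0 : ℝ), x * ((1 - F x ^ 2) / 2))
        ≤ (∫ x in Set.Ioi (0 : ℝ), x * ((1 - FT x ^ 2) / 2))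
    ∧ (∫ x in Set.Ioi (0 : ℝ), x * ((1 - FT x ^ 2) / 2))
        ≤ B₂ * (∫ x in Set.Ioi (0 : ℝ), x * ((1 - F x ^ 2) / 2)) := by
  have hF_mem : ∀ x, F x ∈ Set.Icc (0 : ℝ) 1 := fun x => by
    rw [hF]
    exact ⟨ENNReal.toReal_nonneg, measureReal_le_one⟩
  have hFT_mono : Monotone FT := fun x y hxy => by
    rw [hFT, hFT]
    exact measureReal_mono (fun ω (hω : T ω ≤ x) => hω.trans hxy)
  have hbounds : ∀ x ∈ Set.Ioi (0 : ℝ),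
      B₁ * (x * ((1 - F x ^ 2) / 2)) ≤ x * ((1 - FT x ^ 2) / 2) ∧
        x * ((1 - FT x ^ 2) / 2) ≤ B₂ * (x * ((1 - F x ^ 2) / 2)) := by
    intro x hx
    have hx0 : 0 ≤ x := le_of_lt hx
    rw [hdist x hx0, mul_left_comm, mul_left_comm B₂]
    rcases (hF_mem x).2.lt_or_eq with h | h
    · obtain ⟨hl, hu⟩ := hratio (F x) ⟨(hF_mem x).1, h⟩
      exact ⟨mul_le_mul_of_nonneg_left hl hx0, mul_le_mul_of_nonneg_left hu hx0⟩
    · simp [h, hq1]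
  have hmeas : Measurable (fun x => x * ((1 - FT x ^ 2) / 2)) := by
    have := hFT_mono.measurable
    fun_prop
  have hint_T : IntegrableOn (fun x => x * ((1 - FT x ^ 2) / 2)) (Set.Ioi 0) := by
    refine integrable_of_le_of_le hmeas.aestronglyMeasurable ?_ ?_
      (hint.const_mul B₁) (hint.const_mul B₂)
    · exact (ae_restrict_mem measurableSet_Ioi).mono fun x hx => (hbounds x hx).1
    · exact (ae_restrict_mem measurableSet_Ioi).mono fun x hx => (hbounds x hx).2
  rw [← integral_const_mul, ← integral_const_mul]
  exact ⟨setIntegral_mono_on (hint.const_mul B₁) hint_T measurableSet_Ioi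
      fun x hx => (hbounds x hx).1,
    setIntegral_mono_on hint_T (hint.const_mul B₂) measurableSet_Ioi
      fun x hx => (hbounds x hx).2⟩
end

section
/- Let X be a non-negative random variable with cumulative distribution function F, let q₁ and q₂ be distortion functions, and let T₁ and T₂ be non-negative random variables with F_{T₁}(x) = q₁(F(x)) and F_{T₂}(x) = q₂(F(x)) for all x ≥ 0, where η̄¹J(T₁) is finite. If D₁ and D₂ are constants with 0 ≤ D₁ and D₁·φ(q₁(u)) ≤ φ(q₂(u)) ≤ D₂·φ(q₁(u)) for all u ∈ [0,1), where φ(u) = (1 − u²)/2, then D₁·η̄¹J(T₁) ≤ η̄¹J(T₂) ≤ D₂·η̄¹J(T₁). -/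
open MeasureTheory Real

/-- Let `T₁` and `T₂` have cdfs `q₁ ∘ F` and `q₂ ∘ F`, where `F` is the
cdf of a non-negative random variable `X` and `q₁, q₂` are distortion functions, with
`η̄¹J(T₁)` finite. If `0 ≤ D₁` and `D₁ φ(q₁ u) ≤ φ(q₂ u) ≤ D₂ φ(q₁ u)` for all
`u ∈ [0,1)`, where `φ(u) = (1-u²)/2`, then `D₁ η̄¹J(T₁) ≤ η̄¹J(T₂) ≤ D₂ η̄¹J(T₁)`. -/
theorem wncj_two_distortions_bounds
    {Ω : Type*} [MeasurableSpace Ω] (μ : Measure Ω) [IsProbabilityMeasure μ]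
    (X T₁ T₂ : Ω → ℝ) (hX : Measurable X) (hT₁ : Measurable T₁) (hT₂ : Measurable T₂)
    (h0 : ∀ ω, 0 ≤ X ω) (h0T₁ : ∀ ω, 0 ≤ T₁ ω) (h0T₂ : ∀ ω, 0 ≤ T₂ ω)
    (F F₁ F₂ : ℝ → ℝ)
    (hF : ∀ x, F x = (μ {ω | X ω ≤ x}).toReal)
    (hF₁ : ∀ x, F₁ x = (μ {ω | T₁ ω ≤ x}).toReal)
    (hF₂ : ∀ x, F₂ x = (μ {ω | T₂ ω ≤ x}).toReal)
    (q₁ q₂ : ℝ → ℝ)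
    (hq₁_cont : ContinuousOn q₁ (Set.Icc 0 1))
    (hq₁_mono : MonotoneOn q₁ (Set.Icc 0 1))
    (hq₁_maps : ∀ u ∈ Set.Icc (0 : ℝ) 1, q₁ u ∈ Set.Icc (0 : ℝ) 1)
    (hq₁0 : q₁ 0 = 0) (hq₁1 : q₁ 1 = 1)
    (hq₂_cont : ContinuousOn q₂ (Set.Icc 0 1))
    (hq₂_mono : MonotoneOn q₂ (Set.Icc 0 1))
    (hq₂_maps : ∀ u ∈ Set.Icc (0 : ℝ) 1, q₂ u ∈ Set.Icc (0 : ℝ) 1)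
    (hq₂0 : q₂ 0 = 0) (hq₂1 : q₂ 1 = 1)
    (hdist₁ : ∀ x : ℝ, 0 ≤ x → F₁ x = q₁ (F x))
    (hdist₂ : ∀ x : ℝ, 0 ≤ x → F₂ x = q₂ (F x))
    (hint₁ : IntegrableOn (fun x => x * ((1 - F₁ x ^ 2) / 2)) (Set.Ioi 0))
    (D₁ D₂ : ℝ) (hD₁ : 0 ≤ D₁)
    (hratio : ∀ u ∈ Set.Ico (0 : ℝ) 1,
      D₁ * ((1 - q₁ u ^ 2) / 2) ≤ (1 - q₂ u ^ 2) / 2 ∧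
        (1 - q₂ u ^ 2) / 2 ≤ D₂ * ((1 - q₁ u ^ 2) / 2)) :
    D₁ * (∫ x in Set.Ioi (0 : ℝ), x * ((1 - F₁ x ^ 2) / 2))
        ≤ (∫ x in Set.Ioi (0 : ℝ), x * ((1 - F₂ x ^ 2) / 2))
    ∧ (∫ x in Set.Ioi (0 : ℝ), x * ((1 - F₂ x ^ 2) / 2))
        ≤ D₂ * (∫ x in Set.Ioi (0 : ℝ), x * ((1 - F₁ x ^ 2) / 2)) := by
  have hF_mem : ∀ x, F x ∈ Set.Icc (0 : ℝ) 1 := fun x => by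
    rw [hF]
    exact ⟨ENNReal.toReal_nonneg, measureReal_le_one⟩
  have hF₂_mono : Monotone F₂ := fun x y hxy => by
    rw [hF₂, hF₂]
    exact measureReal_mono fun ω (hω : T₂ ω ≤ x) => hω.trans hxy
  have hφ : ∀ u ∈ Set.Icc (0 : ℝ) 1,
      D₁ * ((1 - q₁ u ^ 2) / 2) ≤ (1 - q₂ u ^ 2) / 2 ∧
        (1 - q₂ u ^ 2) / 2 ≤ D₂ * ((1 - q₁ u ^ 2) / 2) := fun u hu => by
    rcases hu.2.lt_or_eq with h | rfl
    · exact hratio u ⟨hu.1, h⟩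
    · simp [hq₁1, hq₂1]
  have hlower : ∀ x ∈ Set.Ioi (0 : ℝ),
      D₁ * (x * ((1 - F₁ x ^ 2) / 2)) ≤ x * ((1 - F₂ x ^ 2) / 2) := fun x hx => by
    rw [hdist₁ x (le_of_lt hx), hdist₂ x (le_of_lt hx), mul_left_comm]
    exact mul_le_mul_of_nonneg_left (hφ _ (hF_mem x)).1 (le_of_lt hx)
  have hupper : ∀ x ∈ Set.Ioi (0 : ℝ),
      x * ((1 - F₂ x ^ 2) / 2) ≤ D₂ * (x * ((1 - F₁ x ^ 2) / 2)) := fun x hx => by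
    rw [hdist₁ x (le_of_lt hx), hdist₂ x (le_of_lt hx), mul_left_comm D₂]
    exact mul_le_mul_of_nonneg_left (hφ _ (hF_mem x)).2 (le_of_lt hx)
  have hint₂ : IntegrableOn (fun x => x * ((1 - F₂ x ^ 2) / 2)) (Set.Ioi 0) := by
    have hmeas : Measurable fun x => x * ((1 - F₂ x ^ 2) / 2) :=
      measurable_id.mul (((hF₂_mono.measurable.pow_const 2).const_sub 1).div_const 2)
    refine (hint₁.const_mul D₂).mono' hmeas.aestronglyMeasurable ?_
    filter_upwards [ae_restrict_mem measurableSet_Ioi] with x hx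
    have hx0 : 0 ≤ x := le_of_lt hx
    have hq := hq₂_maps _ (hF_mem x)
    have hnonneg : 0 ≤ x * ((1 - F₂ x ^ 2) / 2) := by
      rw [hdist₂ x hx0]
      exact mul_nonneg hx0 (by nlinarith [hq.1, hq.2])
    rw [Real.norm_of_nonneg hnonneg]
    exact hupper x hx
  rw [← integral_const_mul, ← integral_const_mul]
  exact ⟨setIntegral_mono_on (hint₁.const_mul D₁) hint₂ measurableSet_Ioi hlower,
    setIntegral_mono_on hint₂ (hint₁.const_mul D₂) measurableSet_Ioi hupper⟩
end
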